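/- For every A ≥ 1 there exist constants C > 0 and τ₀ ∈ (0,1), depending only on A, such that for all τ ∈ (0, τ₀), every P₁ ∈ S³, and every t₁ with A⁻¹ τ^{−1/2} < t₁ < A τ^{−1/2}, one has | ∫_{S³} ((1 − ⟨x,P₁⟩)/(1 + ⟨x,P₁⟩)) · δ_{P₁,t₁}(x)^{3−τ} dx − 6π²/t₁² | ≤ C τ² |log τ|. -/

import Mathlib

open MeasureTheory Real Set Metric
open scoped RealInnerProductSpace

noncomputable section

/-- The unit sphere `S³ ⊂ ℝ⁴`. -/
abbrev S3 : Set (EuclideanSpace ℝ (Fin 4)) := Metric.sphere (0 : EuclideanSpace ℝ (Fin 4)) 1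

/-- The surface (Riemannian volume) measure on `S³`, realized as the measure on the unit
sphere induced by the Lebesgue measure of `ℝ⁴` (so that the total mass is `2π²`). -/
def μS3 : Measure S3 := (volume : Measure (EuclideanSpace ℝ (Fin 4))).toSphere

/-- The standard bubble `δ_{P,t}(x) = t / (1 + ((t²−1)/2)(1 − ⟨x,P⟩))` on `S³`. -/
def bubble (P : S3) (t : ℝ) (x : S3) : ℝ :=
  t / (1 + ((t ^ 2 - 1) / 2) *
    (1 - ⟪(x : EuclideanSpace ℝ (Fin 4)), (P : EuclideanSpace ℝ (Fin 4))⟫))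

/-- The geodesic distance on the unit sphere: `d(P,Q) = arccos ⟨P,Q⟩`. -/
def geoDist (P Q : S3) : ℝ :=
  Real.arccos ⟪(P : EuclideanSpace ℝ (Fin 4)), (Q : EuclideanSpace ℝ (Fin 4))⟫

/-- The Green's function `G_P(Q) = 1/(1 − ⟨P,Q⟩) = 1/(1 − cos d(P,Q))`. -/
def green (P Q : S3) : ℝ :=
  1 / (1 - ⟪(P : EuclideanSpace ℝ (Fin 4)), (Q : EuclideanSpace ℝ (Fin 4))⟫)

/-- The weight `(1 − ⟨x,P⟩)/(1 + ⟨x,P⟩) = tan²(d(x,P)/2)`, the squared Euclidean norm of the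
stereographic coordinate of `x` when `P` is projected to the origin (denoted `|P−P₁|²`
in the paper). -/
def stereoWeight (P x : S3) : ℝ :=
  (1 - ⟪(x : EuclideanSpace ℝ (Fin 4)), (P : EuclideanSpace ℝ (Fin 4))⟫) /
    (1 + ⟪(x : EuclideanSpace ℝ (Fin 4)), (P : EuclideanSpace ℝ (Fin 4))⟫)

/-- Polar coordinates for the Lebesgue integral of a nonnegative function. -/
theorem lintegral_eq_lintegral_toSphere {E : Type*} [NormedAddCommGroup E] [NormedSpace ℝ E]
    [FiniteDimensional ℝ E] [Nontrivial E] [MeasurableSpace E] [BorelSpace E] (μ : Measure E)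
    [μ.IsAddHaarMeasure] {H : E → ENNReal} (hH : Measurable H) :
    ∫⁻ x, H x ∂μ = ∫⁻ r in Ioi (0 : ℝ), ENNReal.ofReal (r ^ (Module.finrank ℝ E - 1)) *
      ∫⁻ u : sphere (0 : E) 1, H (r • (u : E)) ∂μ.toSphere := by
  have hs : Measurable fun p : sphere (0 : E) 1 × Ioi (0 : ℝ) => H ((p.2 : ℝ) • (p.1 : E)) :=
    hH.comp (by fun_prop)
  calc ∫⁻ x, H x ∂μ = ∫⁻ x in ({0}ᶜ : Set E), H x ∂μ := by
        rw [restrict_compl_singleton]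
    _ = ∫⁻ x : ({0}ᶜ : Set E), H x ∂(μ.comap (↑)) :=
        (lintegral_subtype_comap (measurableSet_singleton _).compl _).symm
    _ = ∫⁻ p : sphere (0 : E) 1 × Ioi (0 : ℝ), H ((p.2 : ℝ) • (p.1 : E))
          ∂(μ.toSphere.prod (Measure.volumeIoiPow (Module.finrank ℝ E - 1))) := by
        rw [← μ.measurePreserving_homeomorphUnitSphereProd.lintegral_comp hs]
        refine lintegral_congr fun x => ?_
        congr 1
        exact congrArg Subtype.val ((homeomorphUnitSphereProd E).symm_apply_apply x).symm
    _ = ∫⁻ r : Ioi (0 : ℝ), ∫⁻ u : sphere (0 : E) 1, H ((r : ℝ) • (u : E)) ∂μ.toSphere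
          ∂(Measure.volumeIoiPow (Module.finrank ℝ E - 1)) :=
        lintegral_prod_symm' _ hs
    _ = _ := by
        rw [Measure.volumeIoiPow, lintegral_withDensity_eq_lintegral_mul _ (by fun_prop)
          hs.lintegral_prod_left']
        exact lintegral_subtype_comap measurableSet_Ioi fun r : ℝ =>
          ENNReal.ofReal (r ^ (Module.finrank ℝ E - 1)) *
            ∫⁻ u : sphere (0 : E) 1, H (r • (u : E)) ∂μ.toSphere

theorem lintegral_norm_euclideanSpace_fin_three {g : ℝ → ENNReal} (hg : Measurable g) :
    ∫⁻ y : EuclideanSpace ℝ (Fin 3), g ‖y‖ =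
      ∫⁻ s in Ioi (0 : ℝ), ENNReal.ofReal (4 * π * s ^ 2) * g s := by
  have hg' : Measurable fun y : EuclideanSpace ℝ (Fin 3) => g ‖y‖ := by fun_prop
  rw [lintegral_eq_lintegral_toSphere volume hg']
  refine setLIntegral_congr_fun measurableSet_Ioi fun s hs => ?_
  have hs' : 0 < s := hs
  have hsphere : (volume : Measure (EuclideanSpace ℝ (Fin 3))).toSphere univ =
      ENNReal.ofReal (4 * π) := by
    rw [Measure.toSphere_apply_univ, EuclideanSpace.volume_ball_fin_three]
    simp only [finrank_euclideanSpace, Fintype.card_fin, ENNReal.ofReal_one, one_pow, one_mul]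
    rw [← ENNReal.ofReal_natCast, ← ENNReal.ofReal_mul (by positivity)]
    congr 1; push_cast; ring
  have hnorm (u : sphere (0 : EuclideanSpace ℝ (Fin 3)) 1) :
      ‖s • (u : EuclideanSpace ℝ (Fin 3))‖ = s := by
    rw [norm_smul, norm_eq_of_mem_sphere u, mul_one, norm_of_nonneg hs'.le]
  simp only [hnorm, lintegral_const, hsphere, finrank_euclideanSpace,
    Fintype.card_fin]
  rw [mul_comm (4 * π), ENNReal.ofReal_mul (sq_nonneg s), mul_assoc, mul_comm (g s)]

/-- Fubini for `ℝ⁴ = ℝ × ℝ³`, for functions of the first coordinate and the norm. -/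
theorem lintegral_coord_norm_euclideanSpace_fin_four {F : ℝ → ℝ → ENNReal}
    (hF : Measurable (Function.uncurry F)) :
    ∫⁻ x : EuclideanSpace ℝ (Fin 4), F (x 0) ‖x‖ =
      ∫⁻ a : ℝ, ∫⁻ y : EuclideanSpace ℝ (Fin 3), F a √(a ^ 2 + ‖y‖ ^ 2) := by
  have h1 : Measurable fun v : Fin 4 → ℝ => F (v 0) √(v 0 ^ 2 + ∑ i : Fin 3, v i.succ ^ 2) :=
    hF.comp (f := fun v : Fin 4 → ℝ => (v 0, √(v 0 ^ 2 + ∑ i : Fin 3, v i.succ ^ 2)))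
      (by fun_prop)
  have h2 : Measurable fun p : ℝ × (Fin 3 → ℝ) => F p.1 √(p.1 ^ 2 + ∑ i : Fin 3, p.2 i ^ 2) :=
    hF.comp (f := fun p : ℝ × (Fin 3 → ℝ) => (p.1, √(p.1 ^ 2 + ∑ i : Fin 3, p.2 i ^ 2)))
      (by fun_prop)
  calc ∫⁻ x : EuclideanSpace ℝ (Fin 4), F (x 0) ‖x‖
      = ∫⁻ v : Fin 4 → ℝ, F (v 0) √(v 0 ^ 2 + ∑ i : Fin 3, v i.succ ^ 2) := by
        rw [← (PiLp.volume_preserving_ofLp (Fin 4)).lintegral_comp h1]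
        simp only [EuclideanSpace.norm_eq, Fin.sum_univ_succ (n := 3), norm_eq_abs, sq_abs]
    _ = ∫⁻ p : ℝ × (Fin 3 → ℝ), F p.1 √(p.1 ^ 2 + ∑ i : Fin 3, p.2 i ^ 2) := by
        rw [← (volume_preserving_piFinSuccAbove (fun _ : Fin 4 => ℝ) 0).lintegral_comp h2]
        rfl
    _ = ∫⁻ a : ℝ, ∫⁻ v : Fin 3 → ℝ, F a √(a ^ 2 + ∑ i : Fin 3, v i ^ 2) :=
        lintegral_prod _ h2.aemeasurable
    _ = _ := by
        refine lintegral_congr fun a => ?_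
        have ha : Measurable fun v : Fin 3 → ℝ => F a √(a ^ 2 + ∑ i : Fin 3, v i ^ 2) :=
          h2.comp (measurable_prodMk_left (x := a))
        rw [← (PiLp.volume_preserving_ofLp (Fin 3)).lintegral_comp ha]
        simp only [EuclideanSpace.norm_sq_eq, norm_eq_abs, sq_abs]

theorem exists_orthonormalBasis_apply_zero_eq (P : S3) :
    ∃ b : OrthonormalBasis (Fin 4) ℝ (EuclideanSpace ℝ (Fin 4)), b 0 = P := by
  have hP : Orthonormal ℝ (({0} : Set (Fin 4)).domRestrict
      fun _ => (P : EuclideanSpace ℝ (Fin 4))) :=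
    orthonormal_subsingleton_iff.2 fun _ => norm_eq_of_mem_sphere P
  obtain ⟨b, hb⟩ := hP.exists_orthonormalBasis_extension_of_card_eq (by simp)
  exact ⟨b, hb 0 rfl⟩

/-- The integral of a zonal function over the unit ball of `ℝ⁴`, in polar coordinates on the
half plane spanned by the axis and the distance to it. -/
theorem lintegral_cos_angle_ball {f : ℝ → ENNReal} (hf : Measurable f) (P : S3) :
    ∫⁻ x : EuclideanSpace ℝ (Fin 4),
        f (⟪x, (P : EuclideanSpace ℝ (Fin 4))⟫ / ‖x‖) * (Iio 1).indicator 1 ‖x‖ =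
      (∫⁻ r in Ioi (0 : ℝ), ENNReal.ofReal (r ^ 3) * (Iio 1).indicator 1 r) *
        ∫⁻ θ in Ioo 0 π, ENNReal.ofReal (4 * π * sin θ ^ 2) * f (cos θ) := by
  obtain ⟨b, hb⟩ := exists_orthonormalBasis_apply_zero_eq P
  have hk : Measurable ((Iio (1 : ℝ)).indicator (1 : ℝ → ENNReal)) :=
    measurable_one.indicator measurableSet_Iio
  set k : ℝ → ENNReal := (Iio (1 : ℝ)).indicator 1
  set F : ℝ → ℝ → ENNReal := fun a n => f (a / n) * k n
  have hF : Measurable (Function.uncurry F) := by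
    change Measurable fun p : ℝ × ℝ => f (p.1 / p.2) * k p.2
    fun_prop
  have hx : Measurable fun x : EuclideanSpace ℝ (Fin 4) => F (x 0) ‖x‖ :=
    hF.comp (f := fun x : EuclideanSpace ℝ (Fin 4) => (x 0, ‖x‖)) (by fun_prop)
  set G : ℝ × ℝ → ENNReal := (univ ×ˢ Ioi (0 : ℝ)).indicator fun p =>
    ENNReal.ofReal (4 * π * p.2 ^ 2) * F p.1 √(p.1 ^ 2 + p.2 ^ 2)
  have hF2 : Measurable fun p : ℝ × ℝ => F p.1 √(p.1 ^ 2 + p.2 ^ 2) :=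
    hF.comp (f := fun p : ℝ × ℝ => (p.1, √(p.1 ^ 2 + p.2 ^ 2))) (by fun_prop)
  have hG : Measurable G := Measurable.indicator (by fun_prop) (by measurability)
  have hθ : Measurable fun θ : ℝ => ENNReal.ofReal (4 * π * sin θ ^ 2) * f (cos θ) := by
    fun_prop
  have hGpolar (r θ : ℝ) (hr : 0 < r) (hθ : θ ∈ Ioo (-π) π) :
      ENNReal.ofReal r * G (r * cos θ, r * sin θ) = (ENNReal.ofReal (r ^ 3) * k r) *
        (Ioo 0 π).indicator (fun θ => ENNReal.ofReal (4 * π * sin θ ^ 2) * f (cos θ)) θ := by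
    by_cases h : 0 < θ
    · have hsin : 0 < sin θ := sin_pos_of_pos_of_lt_pi h hθ.2
      have hsq : √((r * cos θ) ^ 2 + (r * sin θ) ^ 2) = r := by
        rw [mul_pow, mul_pow, ← mul_add, cos_sq_add_sin_sq, mul_one, sqrt_sq hr.le]
      rw [indicator_of_mem (show θ ∈ Ioo 0 π from ⟨h, hθ.2⟩),
        show G (r * cos θ, r * sin θ) = _ from
          indicator_of_mem (mk_mem_prod (mem_univ _) (mul_pos hr hsin)) _]
      simp only [F, hsq, mul_div_cancel_left₀ _ hr.ne']
      rw [mul_pow, mul_left_comm (4 * π), ENNReal.ofReal_mul (by positivity), pow_succ' r 2,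
        ENNReal.ofReal_mul hr.le]
      ring
    · have hsin : sin θ ≤ 0 := sin_nonpos_of_nonpos_of_neg_pi_le (not_lt.1 h) hθ.1.le
      rw [indicator_of_notMem (fun hmem => h hmem.1),
        show G (r * cos θ, r * sin θ) = _ from indicator_of_notMem
          (fun hmem => not_lt.2 (mul_nonpos_of_nonneg_of_nonpos hr.le hsin) hmem.2) _]
      simp
  calc ∫⁻ x : EuclideanSpace ℝ (Fin 4), f (⟪x, (P : EuclideanSpace ℝ (Fin 4))⟫ / ‖x‖) * k ‖x‖
      = ∫⁻ x : EuclideanSpace ℝ (Fin 4), F (x 0) ‖x‖ := by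
        rw [← b.measurePreserving_repr.lintegral_comp hx]
        simp only [F, b.repr.norm_map, b.repr_apply_apply, hb, real_inner_comm]
    _ = ∫⁻ a : ℝ, ∫⁻ s : ℝ, G (a, s) := by
        rw [lintegral_coord_norm_euclideanSpace_fin_four hF]
        refine lintegral_congr fun a => ?_
        have ha : Measurable fun s : ℝ => F a √(a ^ 2 + s ^ 2) :=
          hF2.comp (measurable_prodMk_left (x := a))
        rw [lintegral_norm_euclideanSpace_fin_three ha, ← lintegral_indicator measurableSet_Ioi]
        refine lintegral_congr fun s => ?_
        by_cases hs : s ∈ Ioi (0 : ℝ)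
        · simp [G, hs, indicator]
        · simp [G, hs, indicator]
    _ = ∫⁻ p : ℝ × ℝ, G p := (lintegral_prod _ hG.aemeasurable).symm
    _ = ∫⁻ p in Ioi (0 : ℝ) ×ˢ Ioo (-π) π, (ENNReal.ofReal (p.1 ^ 3) * k p.1) *
          (Ioo 0 π).indicator (fun θ => ENNReal.ofReal (4 * π * sin θ ^ 2) * f (cos θ)) p.2 := by
        rw [← lintegral_comp_polarCoord_symm]
        refine setLIntegral_congr_fun (measurableSet_Ioi.prod measurableSet_Ioo) fun p hp => ?_
        exact hGpolar p.1 p.2 hp.1 hp.2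
    _ = _ := by
        rw [Measure.volume_eq_prod, ← Measure.prod_restrict,
          lintegral_prod_mul (f := fun r : ℝ => ENNReal.ofReal (r ^ 3) * k r) (by fun_prop)
            (hθ.indicator measurableSet_Ioo).aemeasurable,
          lintegral_indicator measurableSet_Ioo, Measure.restrict_restrict measurableSet_Ioo,
          inter_eq_left.2 (Ioo_subset_Ioo_left (by linarith [pi_pos]))]

/-- Integration of zonal functions on `S³`. -/
theorem lintegral_inner_μS3 {f : ℝ → ENNReal} (hf : Measurable f) (P : S3) :
    ∫⁻ x : S3, f ⟪(x : EuclideanSpace ℝ (Fin 4)), (P : EuclideanSpace ℝ (Fin 4))⟫ ∂μS3 =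
      ∫⁻ θ in Ioo 0 π, ENNReal.ofReal (4 * π * sin θ ^ 2) * f (cos θ) := by
  have hk : Measurable ((Iio (1 : ℝ)).indicator (1 : ℝ → ENNReal)) :=
    measurable_one.indicator measurableSet_Iio
  have hfP : Measurable fun x : S3 =>
      f ⟪(x : EuclideanSpace ℝ (Fin 4)), (P : EuclideanSpace ℝ (Fin 4))⟫ := hf.comp (by fun_prop)
  have hH : Measurable fun x : EuclideanSpace ℝ (Fin 4) =>
      f (⟪x, (P : EuclideanSpace ℝ (Fin 4))⟫ / ‖x‖) * (Iio 1).indicator 1 ‖x‖ := by fun_prop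
  have hball := lintegral_cos_angle_ball hf P
  rw [lintegral_eq_lintegral_toSphere volume hH] at hball
  have hc : ∫⁻ r in Ioi (0 : ℝ), ENNReal.ofReal (r ^ 3) * (Iio 1).indicator 1 r =
      ENNReal.ofReal (1 / 4) := by
    have h4 := Measure.volumeIoiPow_apply_Iio 3 ⟨1, mem_Ioi.2 one_pos⟩
    rw [Measure.volumeIoiPow, withDensity_apply _ measurableSet_Iio,
      setLIntegral_subtype measurableSet_Ioi _ fun a : ℝ => ENNReal.ofReal (a ^ 3),
      image_subtype_val_Ioi_Iio] at h4
    norm_num [-one_div] at h4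
    rw [← h4, ← Ioi_inter_Iio, inter_comm, ← Measure.restrict_restrict measurableSet_Iio,
      ← lintegral_indicator measurableSet_Iio]
    refine lintegral_congr fun r => ?_
    by_cases hr : r ∈ Iio (1 : ℝ) <;> simp [hr]
  have hsphere : ∫⁻ r in Ioi (0 : ℝ),
      ENNReal.ofReal (r ^ (Module.finrank ℝ (EuclideanSpace ℝ (Fin 4)) - 1)) *
        ∫⁻ u : S3, f (⟪r • (u : EuclideanSpace ℝ (Fin 4)), (P : EuclideanSpace ℝ (Fin 4))⟫ /
          ‖r • (u : EuclideanSpace ℝ (Fin 4))‖) *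
            (Iio 1).indicator 1 ‖r • (u : EuclideanSpace ℝ (Fin 4))‖
              ∂(volume : Measure (EuclideanSpace ℝ (Fin 4))).toSphere =
      (∫⁻ r in Ioi (0 : ℝ), ENNReal.ofReal (r ^ 3) * (Iio 1).indicator 1 r) *
        ∫⁻ x : S3, f ⟪(x : EuclideanSpace ℝ (Fin 4)), (P : EuclideanSpace ℝ (Fin 4))⟫ ∂μS3 := by
    rw [← lintegral_mul_const _ (by fun_prop)]
    refine setLIntegral_congr_fun measurableSet_Ioi fun r hr => ?_
    have hr' : 0 < r := hr
    have hnorm (u : S3) : ‖r • (u : EuclideanSpace ℝ (Fin 4))‖ = r := by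
      rw [norm_smul, norm_eq_of_mem_sphere u, mul_one, norm_of_nonneg hr'.le]
    simp only [hnorm, real_inner_smul_left, mul_div_cancel_left₀ _ hr'.ne',
      finrank_euclideanSpace, Fintype.card_fin]
    rw [lintegral_mul_const _ hfP, mul_assoc, mul_comm (lintegral _ _)]
    rfl
  rw [hsphere, hc] at hball
  exact (ENNReal.mul_right_inj (by norm_num) ENNReal.ofReal_ne_top).1 hball

theorem one_add_cos_add_mul_pos {t : ℝ} (ht : 0 < t) (θ : ℝ) :
    0 < (1 + cos θ) + t * (1 - cos θ) := by
  rcases eq_or_lt_of_le (neg_one_le_cos θ) with h | h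
  · rw [← h]; linarith
  · nlinarith [cos_le_one θ]

/-- A smooth branch of `arctan (t * tan (θ / 2))`. -/
theorem hasDerivAt_arctan_mul_tan_half {t : ℝ} (ht : 0 < t) (θ : ℝ) :
    HasDerivAt
      (fun θ => θ / 2 + arctan (sin θ * (t - 1) / ((1 + cos θ) + t * (1 - cos θ))))
      (t / ((1 + cos θ) + t ^ 2 * (1 - cos θ))) θ := by
  have hN := one_add_cos_add_mul_pos ht θ
  have hM := one_add_cos_add_mul_pos (pow_pos ht 2) θ
  have hden : HasDerivAt (fun θ => (1 + cos θ) + t * (1 - cos θ)) (-sin θ + t * sin θ) θ := by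
    exact (((hasDerivAt_cos θ).const_add 1).fun_add
      (((hasDerivAt_cos θ).const_sub 1).const_mul t)).congr_deriv (by ring)
  have h := ((hasDerivAt_id' θ).div_const 2).fun_add
    ((((hasDerivAt_sin θ).mul_const (t - 1)).fun_div hden hN.ne').arctan)
  refine h.congr_deriv ?_
  have hsq : ((1 + cos θ) + t * (1 - cos θ)) ^ 2 + (sin θ * (t - 1)) ^ 2 =
      2 * ((1 + cos θ) + t ^ 2 * (1 - cos θ)) := by
    linear_combination (t - 1) ^ 2 * sin_sq_add_cos_sq θ
  have hinv : 1 / (1 + (sin θ * (t - 1) / ((1 + cos θ) + t * (1 - cos θ))) ^ 2) =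
      ((1 + cos θ) + t * (1 - cos θ)) ^ 2 / (2 * ((1 + cos θ) + t ^ 2 * (1 - cos θ))) := by
    rw [← hsq]
    have : 0 < ((1 + cos θ) + t * (1 - cos θ)) ^ 2 + (sin θ * (t - 1)) ^ 2 := by positivity
    field_simp
  rw [hinv]
  field_simp
  linear_combination (-(t - 1) ^ 2) * sin_sq_add_cos_sq θ

/-- The primitive of `(1 - cos θ)² (1 + (t² - 1) / 2 * (1 - cos θ))⁻³`, up to normalization. -/
def zonalPrimitive (t θ : ℝ) : ℝ :=
  32 * π / t ^ 2 *
    (3 / 8 * (θ / 2 + arctan (sin θ * (t - 1) / ((1 + cos θ) + t * (1 - cos θ)))) -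
      sin θ * (t * (3 * (1 + cos θ) + 5 * t ^ 2 * (1 - cos θ))) /
        (8 * ((1 + cos θ) + t ^ 2 * (1 - cos θ)) ^ 2))

theorem hasDerivAt_zonalPrimitive {t : ℝ} (ht : 0 < t) (θ : ℝ) :
    HasDerivAt (zonalPrimitive t)
      (4 * π * (1 - cos θ) ^ 2 * (t / (1 + (t ^ 2 - 1) / 2 * (1 - cos θ))) ^ 3) θ := by
  have hM := one_add_cos_add_mul_pos (pow_pos ht 2) θ
  have hden : HasDerivAt (fun θ => 8 * ((1 + cos θ) + t ^ 2 * (1 - cos θ)) ^ 2)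
      (8 * (2 * ((1 + cos θ) + t ^ 2 * (1 - cos θ)) * (-sin θ + t ^ 2 * sin θ))) θ := by
    exact (((((hasDerivAt_cos θ).const_add 1).fun_add
      (((hasDerivAt_cos θ).const_sub 1).const_mul (t ^ 2))).fun_pow 2).const_mul 8).congr_deriv
        (by norm_num)
  have hnum : HasDerivAt (fun θ => sin θ * (t * (3 * (1 + cos θ) + 5 * t ^ 2 * (1 - cos θ))))
      (cos θ * (t * (3 * (1 + cos θ) + 5 * t ^ 2 * (1 - cos θ))) +
        sin θ * (t * (3 * (-sin θ) + 5 * t ^ 2 * sin θ))) θ := by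
    exact ((hasDerivAt_sin θ).fun_mul (((((hasDerivAt_cos θ).const_add 1).const_mul 3).fun_add
      (((hasDerivAt_cos θ).const_sub 1).const_mul (5 * t ^ 2))).const_mul t)).congr_deriv (by ring)
  have h := (((hasDerivAt_arctan_mul_tan_half ht θ).const_mul (3 / 8)).fun_sub
    (hnum.fun_div hden (by positivity))).const_mul (32 * π / t ^ 2)
  refine h.congr_deriv ?_
  have hD : 1 + (t ^ 2 - 1) / 2 * (1 - cos θ) = ((1 + cos θ) + t ^ 2 * (1 - cos θ)) / 2 := by ring
  rw [hD]
  have key : 3 * ((1 + cos θ) + t ^ 2 * (1 - cos θ)) ^ 2 -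
      ((cos θ * (3 * (1 + cos θ) + 5 * t ^ 2 * (1 - cos θ)) +
        sin θ * (3 * (-sin θ) + 5 * t ^ 2 * sin θ)) * ((1 + cos θ) + t ^ 2 * (1 - cos θ)) -
      2 * sin θ * (3 * (1 + cos θ) + 5 * t ^ 2 * (1 - cos θ)) * (-sin θ + t ^ 2 * sin θ)) =
      8 * t ^ 4 * (1 - cos θ) ^ 2 := by
    linear_combination (-(5 * t ^ 2 - 3) * ((1 + cos θ) + t ^ 2 * (1 - cos θ)) +
      2 * (3 * (1 + cos θ) + 5 * t ^ 2 * (1 - cos θ)) * (t ^ 2 - 1)) * sin_sq_add_cos_sq θ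
  set M := (1 + cos θ) + t ^ 2 * (1 - cos θ)
  field_simp
  linear_combination 32 * key

theorem integral_zonal {t : ℝ} (ht : 0 < t) :
    ∫ θ in 0..π, 4 * π * (1 - cos θ) ^ 2 * (t / (1 + (t ^ 2 - 1) / 2 * (1 - cos θ))) ^ 3 =
      6 * π ^ 2 / t ^ 2 := by
  have hD (θ : ℝ) : 1 + (t ^ 2 - 1) / 2 * (1 - cos θ) ≠ 0 := by
    have := one_add_cos_add_mul_pos (pow_pos ht 2) θ
    linarith
  rw [intervalIntegral.integral_eq_sub_of_hasDerivAt
    (fun θ _ => hasDerivAt_zonalPrimitive ht θ)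
    (Continuous.intervalIntegrable (by fun_prop (disch := exact hD _)) _ _)]
  simp [zonalPrimitive]
  field_simp
  ring

theorem lintegral_stereoWeight_mul_bubble_pow (P : S3) {t : ℝ} (ht : 0 < t) :
    ∫⁻ x, ENNReal.ofReal (stereoWeight P x * bubble P t x ^ 3) ∂μS3 =
      ENNReal.ofReal (6 * π ^ 2 / t ^ 2) := by
  have hf : Measurable fun c : ℝ => ENNReal.ofReal
      ((1 - c) / (1 + c) * (t / (1 + (t ^ 2 - 1) / 2 * (1 - c))) ^ 3) := by fun_prop
  have hD (θ : ℝ) : 0 < 1 + (t ^ 2 - 1) / 2 * (1 - cos θ) := by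
    have := one_add_cos_add_mul_pos (pow_pos ht 2) θ
    linarith
  rw [← integral_zonal ht, intervalIntegral.integral_of_le pi_pos.le, integral_Ioc_eq_integral_Ioo,
    ofReal_integral_eq_lintegral_ofReal]
  · refine (lintegral_inner_μS3 hf P).trans ?_
    refine setLIntegral_congr_fun measurableSet_Ioo fun θ hθ => ?_
    have hs : 0 < sin θ := sin_pos_of_mem_Ioo hθ
    have hc : 0 < 1 + cos θ := by nlinarith [sin_sq_add_cos_sq θ, neg_one_le_cos θ]
    rw [← ENNReal.ofReal_mul (by positivity), sin_sq]
    congr 1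
    have := (hD θ).ne'
    field_simp
    ring
  · refine (Continuous.integrableOn_Icc ?_).mono_set Ioo_subset_Icc_self
    have hD' (θ : ℝ) : 1 + (t ^ 2 - 1) / 2 * (1 - cos θ) ≠ 0 := (hD θ).ne'
    fun_prop (disch := exact hD' _)
  · refine Filter.Eventually.of_forall fun θ => ?_
    have := hD θ
    dsimp only [Pi.zero_apply]
    positivity

theorem inner_mem_Icc (P x : S3) :
    ⟪(x : EuclideanSpace ℝ (Fin 4)), (P : EuclideanSpace ℝ (Fin 4))⟫ ∈ Icc (-1 : ℝ) 1 := by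
  have h := abs_real_inner_le_norm (x : EuclideanSpace ℝ (Fin 4)) P
  rw [norm_eq_of_mem_sphere, norm_eq_of_mem_sphere, one_mul] at h
  exact abs_le.1 h

theorem stereoWeight_nonneg (P x : S3) : 0 ≤ stereoWeight P x := by
  obtain ⟨h1, h2⟩ := inner_mem_Icc P x
  exact div_nonneg (by linarith) (by linarith)

theorem bubble_mem_Icc (P x : S3) {t : ℝ} (ht : 1 ≤ t) : bubble P t x ∈ Icc t⁻¹ t := by
  obtain ⟨h1, h2⟩ := inner_mem_Icc P x
  have ht2 : 1 ≤ t ^ 2 := one_le_pow₀ ht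
  unfold bubble
  set c := ⟪(x : EuclideanSpace ℝ (Fin 4)), (P : EuclideanSpace ℝ (Fin 4))⟫
  have hD : 1 ≤ 1 + (t ^ 2 - 1) / 2 * (1 - c) := by nlinarith
  have hD' : 1 + (t ^ 2 - 1) / 2 * (1 - c) ≤ t ^ 2 := by nlinarith
  constructor
  · rw [le_div_iff₀ (by linarith), inv_mul_le_iff₀ (by linarith)]
    linarith
  · exact div_le_self (by linarith) hD

theorem measurable_stereoWeight (P : S3) : Measurable (stereoWeight P) := by
  unfold stereoWeight
  fun_prop

theorem measurable_bubble (P : S3) (t : ℝ) : Measurable (bubble P t) := by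
  unfold bubble
  fun_prop

theorem bubble_pos (P x : S3) {t : ℝ} (ht : 1 ≤ t) : 0 < bubble P t x :=
  (inv_pos.2 (by linarith)).trans_le (bubble_mem_Icc P x ht).1

theorem stereoWeight_mul_bubble_pow_nonneg (P : S3) {t : ℝ} (ht : 1 ≤ t) (x : S3) :
    0 ≤ stereoWeight P x * bubble P t x ^ 3 :=
  mul_nonneg (stereoWeight_nonneg P x) (pow_pos (bubble_pos P x ht) 3).le

theorem measurable_stereoWeight_mul_bubble_pow (P : S3) (t : ℝ) :
    Measurable fun x => stereoWeight P x * bubble P t x ^ 3 :=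
  (measurable_stereoWeight P).mul ((measurable_bubble P t).pow_const 3)

theorem integrable_stereoWeight_mul_bubble_pow (P : S3) {t : ℝ} (ht : 1 ≤ t) :
    Integrable (fun x => stereoWeight P x * bubble P t x ^ 3) μS3 := by
  refine (lintegral_ofReal_ne_top_iff_integrable
    (measurable_stereoWeight_mul_bubble_pow P t).aestronglyMeasurable
    (Filter.Eventually.of_forall (stereoWeight_mul_bubble_pow_nonneg P ht))).1 ?_
  rw [lintegral_stereoWeight_mul_bubble_pow P (by linarith)]
  exact ENNReal.ofReal_ne_top

theorem integral_stereoWeight_mul_bubble_pow (P : S3) {t : ℝ} (ht : 1 ≤ t) :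
    ∫ x, stereoWeight P x * bubble P t x ^ 3 ∂μS3 = 6 * π ^ 2 / t ^ 2 := by
  rw [integral_eq_lintegral_of_nonneg_ae
    (Filter.Eventually.of_forall (stereoWeight_mul_bubble_pow_nonneg P ht))
    (measurable_stereoWeight_mul_bubble_pow P t).aestronglyMeasurable,
    lintegral_stereoWeight_mul_bubble_pow P (by linarith), ENNReal.toReal_ofReal (by positivity)]

theorem abs_rpow_neg_sub_one_le {t δ τ : ℝ} (ht : 1 ≤ t) (hδ : δ ∈ Icc t⁻¹ t) (hτ : 0 ≤ τ) :
    |δ ^ (-τ) - 1| ≤ t ^ τ - 1 := by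
  have ht0 : 0 < t := by linarith
  have hδ0 : 0 < δ := (inv_pos.2 ht0).trans_le hδ.1
  have hs : 0 < t ^ τ := rpow_pos_of_pos ht0 τ
  have hu : δ ^ (-τ) ≤ t ^ τ := by
    rw [rpow_neg hδ0.le, ← inv_rpow hδ0.le]
    exact rpow_le_rpow (inv_pos.2 hδ0).le (inv_le_of_inv_le₀ ht0 hδ.1) hτ
  have hl : (t ^ τ)⁻¹ ≤ δ ^ (-τ) := by
    rw [rpow_neg hδ0.le]
    exact inv_anti₀ (rpow_pos_of_pos hδ0 τ) (rpow_le_rpow hδ0.le hδ.2 hτ)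
  have h2 : 2 - t ^ τ ≤ (t ^ τ)⁻¹ := by
    rw [← sub_nonneg, show (t ^ τ)⁻¹ - (2 - t ^ τ) = (t ^ τ - 1) ^ 2 / t ^ τ by field_simp; ring]
    positivity
  rw [abs_le]
  constructor <;> linarith

theorem abs_integral_stereoWeight_mul_bubble_rpow_sub_le (P : S3) {t τ : ℝ} (ht : 1 ≤ t)
    (hτ : 0 ≤ τ) :
    |(∫ x, stereoWeight P x * bubble P t x ^ (3 - τ) ∂μS3) - 6 * π ^ 2 / t ^ 2| ≤
      (t ^ τ - 1) * (6 * π ^ 2 / t ^ 2) := by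
  have hint := integrable_stereoWeight_mul_bubble_pow P ht
  have hdiff (x : S3) :
      ‖stereoWeight P x * bubble P t x ^ (3 - τ) - stereoWeight P x * bubble P t x ^ 3‖ ≤
        (t ^ τ - 1) * (stereoWeight P x * bubble P t x ^ 3) := by
    have hr : bubble P t x ^ (3 - τ) = bubble P t x ^ 3 * bubble P t x ^ (-τ) := by
      rw [sub_eq_add_neg, rpow_add (bubble_pos P x ht)]
      norm_cast
    rw [hr, ← mul_assoc, ← mul_sub_one, norm_mul, mul_comm,
      norm_of_nonneg (stereoWeight_mul_bubble_pow_nonneg P ht x)]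
    exact mul_le_mul_of_nonneg_right (abs_rpow_neg_sub_one_le ht (bubble_mem_Icc P x ht) hτ)
      (stereoWeight_mul_bubble_pow_nonneg P ht x)
  have hm : Measurable fun x => stereoWeight P x * bubble P t x ^ (3 - τ) :=
    (measurable_stereoWeight P).mul ((measurable_bubble P t).pow_const _)
  have hd : Integrable (fun x => stereoWeight P x * bubble P t x ^ (3 - τ) -
      stereoWeight P x * bubble P t x ^ 3) μS3 :=
    (hint.const_mul _).mono'
      (hm.sub (measurable_stereoWeight_mul_bubble_pow P t)).aestronglyMeasurable
      (Filter.Eventually.of_forall hdiff)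
  have hint' : Integrable (fun x => stereoWeight P x * bubble P t x ^ (3 - τ)) μS3 := by
    simpa using hd.fun_add hint
  rw [← integral_stereoWeight_mul_bubble_pow P ht, ← integral_sub hint' hint,
    ← integral_const_mul]
  exact norm_integral_le_of_norm_le (hint.const_mul _) (Filter.Eventually.of_forall hdiff)

theorem rpow_sub_one_le_of_le_inv {t τ : ℝ} (hτ : 0 < τ) (hτ1 : τ < 1) (ht : 0 < t)
    (h : t ≤ τ⁻¹) : t ^ τ - 1 ≤ exp 1 * (τ * |log τ|) := by
  have hlog : log t ≤ |log τ| := by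
    rw [abs_of_neg (log_neg hτ hτ1), ← log_inv]
    exact log_le_log ht h
  have hbound : τ * |log τ| ≤ 1 := by
    have := log_le_sub_one_of_pos (inv_pos.2 hτ)
    rw [abs_of_neg (log_neg hτ hτ1), ← log_inv]
    calc τ * log τ⁻¹ ≤ τ * τ⁻¹ := by gcongr; linarith
      _ = 1 := mul_inv_cancel₀ hτ.ne'
  set y := τ * |log τ|
  have hy : 0 ≤ y := by positivity
  have hle : t ^ τ ≤ exp y := by
    rw [rpow_def_of_pos ht, mul_comm]
    exact exp_le_exp.2 (mul_le_mul_of_nonneg_left hlog hτ.le)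
  have h1 : exp y * (1 - y) ≤ 1 := by
    calc exp y * (1 - y) ≤ exp y * exp (-y) := by
          gcongr; linarith [add_one_le_exp (-y)]
      _ = 1 := by rw [← exp_add]; simp
  have h2 : exp y * y ≤ exp 1 * y := by gcongr
  linarith

theorem stmt18 (A : ℝ) (hA : 1 ≤ A) :
    ∃ C > 0, ∃ τ₀ ∈ Set.Ioo (0 : ℝ) 1, ∀ τ ∈ Set.Ioo (0 : ℝ) τ₀, ∀ P₁ : S3, ∀ t₁ : ℝ,
      A⁻¹ * τ ^ (-(1 : ℝ) / 2) < t₁ → t₁ < A * τ ^ (-(1 : ℝ) / 2) →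
      |(∫ x, stereoWeight P₁ x * (bubble P₁ t₁ x) ^ ((3 : ℝ) - τ) ∂μS3) -
          6 * π ^ 2 / t₁ ^ 2| ≤ C * τ ^ 2 * |Real.log τ| := by
  have hA0 : 0 < A := by linarith
  refine ⟨exp 1 * (6 * π ^ 2 * A ^ 2), by positivity, (A ^ 2)⁻¹ / 2, ⟨by positivity, ?_⟩, ?_⟩
  · have : (A ^ 2)⁻¹ ≤ 1 := inv_le_one_of_one_le₀ (one_le_pow₀ hA)
    linarith
  rintro τ ⟨hτ, hτA⟩ P t htl htu
  have hA2 : (A ^ 2)⁻¹ ≤ 1 := inv_le_one_of_one_le₀ (one_le_pow₀ hA)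
  have hτ1 : τ < 1 := by linarith
  set u := τ ^ (-(1 : ℝ) / 2)
  have hu : 0 < u := rpow_pos_of_pos hτ _
  have hu2 : u ^ 2 = τ⁻¹ := by
    rw [← rpow_natCast, ← rpow_mul hτ.le, ← rpow_neg_one]
    norm_num
  have hAu : A < u := by
    refine lt_of_pow_lt_pow_left₀ 2 hu.le ?_
    rw [hu2, lt_inv_comm₀ (by positivity) hτ]
    have : 0 < (A ^ 2)⁻¹ := by positivity
    linarith
  have ht1 : 1 ≤ t := by
    refine le_trans ?_ htl.le
    rw [le_inv_mul_iff₀ hA0]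
    linarith
  have htinv : t ≤ τ⁻¹ := by
    rw [← hu2]
    nlinarith
  have ht2 : 6 * π ^ 2 / t ^ 2 ≤ 6 * π ^ 2 * A ^ 2 * τ := by
    have h : (A⁻¹ * u) ^ 2 ≤ t ^ 2 := by gcongr
    rw [mul_pow, hu2, inv_pow, ← mul_inv] at h
    rw [div_eq_mul_inv, mul_assoc (6 * π ^ 2)]
    exact mul_le_mul_of_nonneg_left (inv_le_of_inv_le₀ (by positivity) h) (by positivity)
  calc _ ≤ (t ^ τ - 1) * (6 * π ^ 2 / t ^ 2) :=
        abs_integral_stereoWeight_mul_bubble_rpow_sub_le P ht1 hτ.le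
    _ ≤ (exp 1 * (τ * |log τ|)) * (6 * π ^ 2 * A ^ 2 * τ) := by
        gcongr
        exact rpow_sub_one_le_of_le_inv hτ hτ1 (by linarith) htinv
    _ = _ := by ring
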